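/- Let 0<p<∞ and φ∈𝒢_p with φ(1)=1. Assume lim_{t→0+} φ(t)=0 and lim_{t→∞} t^{-n/p} φ(t) > 0. Then the growth envelope of ℳ_{φ,p}(ℝ^n) equals that of L_p(ℝ^n), namely (t^{-1/p}, p). More precisely: (1) 𝔈_G ℳ_{φ,p}(ℝ^n)(t) ∼ t^{-1/p} for t>0; (2) there exist ε>0 and c>0 such that (∫_0^ε (t^{1/p} f*(t))^p dt/t)^{1/p} ≤ c ‖f|ℳ_{φ,p}(ℝ^n)‖ for all f∈ℳ_{φ,p}(ℝ^n); and (3) if for some 0<v<∞, ε>0 and c>0 the inequality (∫_0^ε (t^{1/p} f*(t))^v dt/t)^{1/v} ≤ c ‖f|ℳ_{φ,p}(ℝ^n)‖ holds for all f∈ℳ_{φ,p}(ℝ^n), then v ≥ p. -/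

import Mathlib

open MeasureTheory Filter Set ENNReal

noncomputable section

abbrev En (n : ℕ) := EuclideanSpace ℝ (Fin n)

/-- The class `𝒢_p`: nondecreasing positive functions on `(0,∞)` such that
`t ↦ φ(t) t^{-n/p}` is nonincreasing. -/
def GClass (n : ℕ) (p : ℝ) (φ : ℝ → ℝ) : Prop :=
  (∀ t : ℝ, 0 < t → 0 < φ t) ∧
    ∀ t r : ℝ, 0 < t → t ≤ r → φ t ≤ φ r ∧ φ r ≤ φ t * (r / t) ^ ((n : ℝ) / p)

/-- The axis-parallel compact cube centred at `x` with side length `r`. -/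
def cube (n : ℕ) (x : En n) (r : ℝ) : Set (En n) := {y | ∀ i, |y i - x i| ≤ r / 2}

/-- The generalised Morrey quasi-norm `‖f | ℳ_{φ,p}(ℝⁿ)‖`. -/
def morreyNorm {F : Type*} [NormedAddCommGroup F] (n : ℕ) (p : ℝ) (φ : ℝ → ℝ)
    (f : En n → F) : ℝ≥0∞ :=
  ⨆ (x : En n) (r : ℝ) (_ : 0 < r),
    ENNReal.ofReal (φ r) *
      ((volume (cube n x r))⁻¹ *
        ∫⁻ y in cube n x r, ENNReal.ofReal (‖f y‖ ^ p)) ^ (1 / p)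

/-- The decreasing rearrangement `f*(t) = inf{σ>0 : |{x : |f(x)|>σ}| ≤ t}`. -/
def rearr {F : Type*} [NormedAddCommGroup F] (n : ℕ) (f : En n → F) (t : ℝ) : ℝ≥0∞ :=
  sInf {σ : ℝ≥0∞ | 0 < σ ∧ volume {x : En n | σ < ENNReal.ofReal ‖f x‖} ≤ ENNReal.ofReal t}

/-- The growth envelope function of the generalised Morrey space `ℳ_{φ,p}(ℝⁿ)`. -/
def morreyEnvelope (n : ℕ) (p : ℝ) (φ : ℝ → ℝ) (t : ℝ) : ℝ≥0∞ :=
  ⨆ (f : En n → ℝ) (_ : Measurable f) (_ : morreyNorm n p φ f ≤ 1), rearr n f t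

end

lemma le_rearr {n : ℕ} {f : En n → ℝ} {t : ℝ} {τ : ℝ≥0∞}
    (h : ENNReal.ofReal t < volume {x : En n | τ ≤ ENNReal.ofReal ‖f x‖}) :
    τ ≤ rearr n f t := by
  refine le_sInf fun σ hσ => ?_
  by_contra! hlt
  exact absurd (hσ.2.trans_lt h)
    (not_lt.2 (measure_mono fun x hx => lt_of_lt_of_le hlt hx))

lemma ofReal_lt_volume_of_lt_rearr {n : ℕ} {f : En n → ℝ} {t : ℝ} {s : ℝ≥0∞} (hs : 0 < s)
    (h : s < rearr n f t) :
    ENNReal.ofReal t < volume {x : En n | s < ENNReal.ofReal ‖f x‖} := by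
  by_contra! hle
  exact absurd (sInf_le ⟨hs, hle⟩ : rearr n f t ≤ s) (not_le.2 h)

lemma antitone_rearr {n : ℕ} (f : En n → ℝ) : Antitone (rearr n f) := fun _ _ hst =>
  sInf_le_sInf fun _ hσ => ⟨hσ.1, hσ.2.trans (ENNReal.ofReal_le_ofReal hst)⟩

lemma rearr_le_of_lintegral {n : ℕ} {p : ℝ} (hp : 0 < p) {f : En n → ℝ} (hf : Measurable f)
    {t : ℝ} (ht : 0 < t) :
    rearr n f t ≤ ((∫⁻ y, ENNReal.ofReal (‖f y‖ ^ p)) / ENNReal.ofReal t) ^ (1 / p) := by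
  refine le_of_forall_lt fun s hs => ?_
  rcases eq_or_ne s 0 with rfl | hs0
  · by_contra! h0
    have h0 : ((∫⁻ y, ENNReal.ofReal (‖f y‖ ^ p)) / ENNReal.ofReal t) ^ (1 / p) = 0 := by
      simpa using h0
    have hI : ∫⁻ y, ENNReal.ofReal (‖f y‖ ^ p) = 0 := by
      rw [ENNReal.rpow_eq_zero_iff_of_pos (by positivity)] at h0
      simpa using h0
    obtain ⟨σ, hσ0, hσ⟩ := exists_between hs
    have h1 := ofReal_lt_volume_of_lt_rearr hσ0 hσ
    have h2 : volume {x : En n | σ < ENNReal.ofReal ‖f x‖} = 0 := by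
      rw [lintegral_eq_zero_iff (by fun_prop)] at hI
      rw [← compl_compl {x : En n | σ < ENNReal.ofReal ‖f x‖}, ← mem_ae_iff]
      filter_upwards [hI] with x hx
      have : ‖f x‖ = 0 := by
        by_contra hne
        have : 0 < ‖f x‖ := lt_of_le_of_ne (norm_nonneg _) (Ne.symm hne)
        have h3 : 0 < ‖f x‖ ^ p := by positivity
        simp only [Pi.zero_apply, ENNReal.ofReal_eq_zero] at hx
        linarith
      simp only [mem_compl_iff, mem_ofPred_eq, this, ENNReal.ofReal_zero, not_lt]
      exact zero_le
    rw [h2] at h1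
    simp at h1
  · have hs0' : 0 < s := pos_iff_ne_zero.2 hs0
    obtain ⟨σ, hσ0, hσ⟩ := exists_between hs
    refine hσ0.trans_le ?_
    have h1 := ofReal_lt_volume_of_lt_rearr (hs0'.trans hσ0) hσ
    have h2 := mul_meas_ge_le_lintegral (μ := volume)
      (f := fun y => ENNReal.ofReal (‖f y‖ ^ p)) (by fun_prop) (σ ^ p)
    have h3 : {x : En n | σ < ENNReal.ofReal ‖f x‖} ⊆
        {x | σ ^ p ≤ ENNReal.ofReal (‖f x‖ ^ p)} := fun x hx => by
      simp only [mem_ofPred_eq] at hx ⊢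
      rw [← ENNReal.ofReal_rpow_of_nonneg (norm_nonneg _) hp.le]
      exact ENNReal.rpow_le_rpow hx.le hp.le
    rw [one_div, ENNReal.le_rpow_inv_iff hp, ENNReal.le_div_iff_mul_le (by simp [ht]) (by simp)]
    exact le_trans (by gcongr; exact h1.le.trans (measure_mono h3)) h2

lemma lintegral_rearr_rpow_le {n : ℕ} {p : ℝ} (hp : 0 < p) {f : En n → ℝ} (hf : Measurable f) :
    ∫⁻ t in Ioi (0 : ℝ), rearr n f t ^ p ≤ ∫⁻ y, ENNReal.ofReal (‖f y‖ ^ p) := by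
  rcases eq_or_ne (∫⁻ y, ENNReal.ofReal (‖f y‖ ^ p)) ∞ with hI | hI
  · rw [hI]; exact le_top
  have hfin : ∀ t : ℝ, 0 < t → rearr n f t ≠ ∞ := fun t ht =>
    ne_top_of_le_ne_top (ENNReal.rpow_ne_top_of_nonneg (by positivity)
      (ENNReal.div_ne_top hI (by simp [ht]))) (rearr_le_of_lintegral hp hf ht)
  have hmeas : Measurable (rearr n f) := (antitone_rearr f).measurable
  calc ∫⁻ t in Ioi (0 : ℝ), rearr n f t ^ p
      = ∫⁻ t in Ioi (0 : ℝ), ENNReal.ofReal ((rearr n f t).toReal ^ p) := by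
        refine setLIntegral_congr_fun measurableSet_Ioi fun t ht => ?_
        rw [← ENNReal.ofReal_rpow_of_nonneg ENNReal.toReal_nonneg hp.le,
          ENNReal.ofReal_toReal (hfin t ht)]
    _ = ENNReal.ofReal p * ∫⁻ s in Ioi (0 : ℝ),
          volume.restrict (Ioi 0) {t : ℝ | s < (rearr n f t).toReal} *
            ENNReal.ofReal (s ^ (p - 1)) :=
        lintegral_rpow_eq_lintegral_meas_lt_mul _
          (Eventually.of_forall fun _ => ENNReal.toReal_nonneg)
          hmeas.ennreal_toReal.aemeasurable hp
    _ ≤ ENNReal.ofReal p * ∫⁻ s in Ioi (0 : ℝ),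
          volume {x : En n | s < ‖f x‖} * ENNReal.ofReal (s ^ (p - 1)) := by
        refine mul_le_mul_right ?_ _
        refine setLIntegral_mono' measurableSet_Ioi fun s hs => ?_
        gcongr ?_ * _
        rw [Measure.restrict_apply (measurableSet_lt measurable_const hmeas.ennreal_toReal)]
        set D := volume {x : En n | s < ‖f x‖} with hD
        rcases eq_or_ne D ∞ with hDt | hDt
        · simp [hDt]
        have hsub : {t : ℝ | s < (rearr n f t).toReal} ∩ Ioi 0 ⊆ Ioo 0 D.toReal := by
          rintro t ⟨ht, ht0⟩
          refine ⟨ht0, ?_⟩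
          have h1 := ofReal_lt_volume_of_lt_rearr (n := n) (f := f) (t := t)
            (s := ENNReal.ofReal s) (by simpa using hs)
            ((ENNReal.ofReal_lt_iff_lt_toReal (le_of_lt hs) (hfin t ht0)).2 ht)
          have h2 : {x : En n | ENNReal.ofReal s < ENNReal.ofReal ‖f x‖} =
              {x | s < ‖f x‖} := by
            ext x
            exact ENNReal.ofReal_lt_ofReal_iff_of_nonneg (le_of_lt hs)
          rw [h2] at h1
          exact (ENNReal.ofReal_lt_iff_lt_toReal (le_of_lt ht0) hDt).1 h1
        refine (measure_mono hsub).trans ?_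
        rw [Real.volume_Ioo, sub_zero, ENNReal.ofReal_toReal hDt]
    _ = ∫⁻ y, ENNReal.ofReal (‖f y‖ ^ p) :=
        (lintegral_rpow_eq_lintegral_meas_lt_mul _ (Eventually.of_forall fun _ => norm_nonneg _)
          hf.norm.aemeasurable hp).symm

lemma lintegral_box {n : ℕ} (i₀ : Fin n) {A : Fin n → Set ℝ} (hA : ∀ i, MeasurableSet (A i))
    {H : ℝ → ℝ≥0∞} (hH : Measurable H) :
    ∫⁻ y in {y : En n | ∀ i, y i ∈ A i}, H (y i₀) =
      (∏ j ∈ Finset.univ.erase i₀, volume (A j)) * ∫⁻ s in A i₀, H s := by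
  have hpi : MeasurableSet (univ.pi A) := MeasurableSet.univ_pi hA
  have h1 := (PiLp.volume_preserving_ofLp (Fin n)).setLIntegral_comp_preimage hpi
    (f := fun z => H (z i₀)) (by fun_prop)
  have h2 : {y : En n | ∀ i, y i ∈ A i} = (@WithLp.ofLp 2 (Fin n → ℝ)) ⁻¹' (univ.pi A) := by
    ext y; simp
  rw [h2, h1, volume_pi, Measure.restrict_pi_pi]
  have h3 := Measure.pi_map_eval (fun i => volume.restrict (A i)) i₀
  rw [← lintegral_map (g := Function.eval i₀) hH (measurable_pi_apply i₀), h3,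
    lintegral_smul_measure]
  simp

lemma cube_eq_box {n : ℕ} (x : En n) (r : ℝ) :
    cube n x r = {y | ∀ i, y i ∈ Icc (x i - r / 2) (x i + r / 2)} := by
  ext y
  simp only [cube, mem_ofPred_eq, mem_Icc, abs_le]
  exact forall_congr' fun i => ⟨fun h => ⟨by linarith [h.1], by linarith [h.2]⟩,
    fun h => ⟨by linarith [h.1], by linarith [h.2]⟩⟩

lemma volume_cube {n : ℕ} (x : En n) {r : ℝ} : volume (cube n x r) = ENNReal.ofReal r ^ n := by
  have h2 : cube n x r = (@WithLp.ofLp 2 (Fin n → ℝ)) ⁻¹'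
      (univ.pi fun i => Icc (x i - r / 2) (x i + r / 2)) := by
    rw [cube_eq_box]
    ext y
    simp only [mem_ofPred_eq, mem_preimage, mem_univ_pi]
  rw [h2, (PiLp.volume_preserving_ofLp (Fin n)).measure_preimage
    (MeasurableSet.univ_pi fun i => measurableSet_Icc).nullMeasurableSet, volume_pi_pi]
  simp only [Real.volume_Icc]
  rw [Finset.prod_congr rfl (fun i _ => by rw [show x i + r / 2 - (x i - r / 2) = r by ring])]
  simp

lemma lintegral_fract_Ico (G : ℝ → ℝ≥0∞) (hG : Measurable G) {N : ℕ} (hN : 0 < N) (j : ℤ) :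
    ∫⁻ s in Ico ((j : ℝ) / N) ((j + 1) / N), G (Int.fract (N * s)) =
      ENNReal.ofReal (1 / N) * ∫⁻ s in Ico (0 : ℝ) 1, G s := by
  have hN' : (0 : ℝ) < N := by exact_mod_cast hN
  have hGf : Measurable fun s : ℝ => G (Int.fract s) := hG.comp measurable_fract
  have h1 := setLIntegral_map (μ := (volume : Measure ℝ)) (g := fun s : ℝ => (N : ℝ) * s)
    (s := Ico (j : ℝ) (j + 1)) measurableSet_Ico hGf (by fun_prop)
  have hpre : (fun s : ℝ => (N : ℝ) * s) ⁻¹' Ico (j : ℝ) (j + 1) =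
      Ico ((j : ℝ) / N) ((j + 1) / N) := by
    ext s
    simp only [mem_preimage, mem_Ico, div_le_iff₀ hN', lt_div_iff₀ hN', mul_comm]
  rw [hpre, Real.map_volume_mul_left hN'.ne', Measure.restrict_smul, lintegral_smul_measure] at h1
  rw [← h1, smul_eq_mul, abs_of_pos (by positivity), one_div]
  congr 1
  have h2 := (measurePreserving_sub_right (volume : Measure ℝ) (j : ℝ)).setLIntegral_comp_preimage
    (s := Ico (0 : ℝ) 1) measurableSet_Ico hG
  have hpre2 : (fun s : ℝ => s - (j : ℝ)) ⁻¹' Ico (0 : ℝ) 1 = Ico (j : ℝ) (j + 1) := by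
    ext s
    simp only [mem_preimage, mem_Ico, sub_nonneg, sub_lt_iff_lt_add']
  rw [hpre2] at h2
  rw [← h2]
  refine setLIntegral_congr_fun measurableSet_Ico fun s hs => ?_
  rw [Int.fract, Int.floor_eq_iff.2 ⟨hs.1, hs.2⟩]

lemma lintegral_fract_Ico_nat (G : ℝ → ℝ≥0∞) (hG : Measurable G) {N : ℕ} (hN : 0 < N) (m : ℤ)
    (k : ℕ) :
    ∫⁻ s in Ico ((m : ℝ) / N) ((m + k) / N), G (Int.fract (N * s)) =
      ENNReal.ofReal (k / N) * ∫⁻ s in Ico (0 : ℝ) 1, G s := by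
  have hN' : (0 : ℝ) < N := by exact_mod_cast hN
  induction k with
  | zero => simp
  | succ k ih =>
    have hU : Ico ((m : ℝ) / N) ((m + (k + 1 : ℕ)) / N) =
        Ico ((m : ℝ) / N) ((m + k) / N) ∪ Ico (((m + k : ℤ) : ℝ) / N) (((m + k : ℤ) + 1) / N) := by
      push_cast
      rw [Ico_union_Ico_eq_Ico (by gcongr; simp) (by gcongr ?_ / _; linarith), add_assoc]
    have hd : Disjoint (Ico ((m : ℝ) / N) ((m + k) / N))
        (Ico (((m + k : ℤ) : ℝ) / N) (((m + k : ℤ) + 1) / N)) := by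
      push_cast
      exact Set.disjoint_left.2 fun s h1 h2 => absurd h1.2 (not_lt.2 h2.1)
    rw [hU, lintegral_union measurableSet_Ico hd, ih, lintegral_fract_Ico G hG hN, ← add_mul,
      ← ENNReal.ofReal_add (by positivity) (by positivity)]
    congr 2
    push_cast
    ring

lemma lintegral_fract_Icc_le (G : ℝ → ℝ≥0∞) (hG : Measurable G) {N : ℕ} (hN : 0 < N) (x r : ℝ)
    (hr : 1 ≤ N * r) :
    ∫⁻ s in Icc (x - r / 2) (x + r / 2), G (Int.fract (N * s)) ≤
      ENNReal.ofReal (3 * r) * ∫⁻ s in Ico (0 : ℝ) 1, G s := by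
  have hN' : (0 : ℝ) < N := by exact_mod_cast hN
  set m := ⌊N * (x - r / 2)⌋ with hm
  set M := ⌊N * (x + r / 2)⌋ + 1 with hM
  have hm1 : (m : ℝ) ≤ N * (x - r / 2) := Int.floor_le _
  have hm2 : N * (x - r / 2) < m + 1 := Int.lt_floor_add_one _
  have hM1 : N * (x + r / 2) < M := by push_cast [hM]; exact Int.lt_floor_add_one _
  have hM2 : (M : ℝ) ≤ N * (x + r / 2) + 1 := by
    push_cast [hM]; linarith [Int.floor_le (N * (x + r / 2))]
  obtain ⟨k, hk⟩ : ∃ k : ℕ, M = m + k := by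
    have : m ≤ M := by
      have : (m : ℝ) ≤ M := by nlinarith
      exact_mod_cast this
    exact ⟨(M - m).toNat, by omega⟩
  have hk' : (M : ℝ) = m + k := by exact_mod_cast hk
  calc _ ≤ ∫⁻ s in Ico ((m : ℝ) / N) ((m + k) / N), G (Int.fract (N * s)) := by
        refine lintegral_mono_set fun s hs => ?_
        rw [mem_Ico, div_le_iff₀ hN', lt_div_iff₀ hN']
        constructor <;> nlinarith [hs.1, hs.2]
    _ ≤ _ := by
        rw [lintegral_fract_Ico_nat G hG hN]
        gcongr
        rw [div_le_iff₀ hN']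
        nlinarith

lemma measurableSet_box {n : ℕ} {A : Fin n → Set ℝ} (hA : ∀ i, MeasurableSet (A i)) :
    MeasurableSet {y : En n | ∀ i, y i ∈ A i} := by
  have : {y : En n | ∀ i, y i ∈ A i} = ⋂ i, (fun y : En n => y i) ⁻¹' A i := by
    ext y; simp
  rw [this]
  exact MeasurableSet.iInter fun i => (by fun_prop : Measurable fun y : En n => y i) (hA i)

lemma ofReal_rpow_div {n : ℕ} {p r : ℝ} (hr : 0 < r) :
    ENNReal.ofReal (r ^ ((n : ℝ) / p)) = (ENNReal.ofReal r ^ n) ^ (1 / p) := by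
  rw [← ENNReal.ofReal_pow hr.le, ENNReal.ofReal_rpow_of_pos (by positivity), ← Real.rpow_natCast,
    ← Real.rpow_mul hr.le, mul_one_div]

lemma lintegral_le_morreyNorm {n : ℕ} {p : ℝ} (hp : 0 < p) {φ : ℝ → ℝ} {c : ℝ} (hc : 0 < c)
    (h : ∀ r : ℝ, 0 < r → c * r ^ ((n : ℝ) / p) ≤ φ r) (f : En n → ℝ) :
    (∫⁻ y, ENNReal.ofReal (‖f y‖ ^ p)) ^ (1 / p) ≤
      ENNReal.ofReal (1 / c) * morreyNorm n p φ f := by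
  have key : ∀ r : ℝ, 0 < r → (∫⁻ y in cube n 0 r, ENNReal.ofReal (‖f y‖ ^ p)) ^ (1 / p) ≤
      ENNReal.ofReal (1 / c) * morreyNorm n p φ f := by
    intro r hr
    have h1 : ENNReal.ofReal (φ r) * ((volume (cube n 0 r))⁻¹ *
        ∫⁻ y in cube n 0 r, ENNReal.ofReal (‖f y‖ ^ p)) ^ (1 / p) ≤ morreyNorm n p φ f :=
      le_iSup_of_le 0 (le_iSup_of_le r (le_iSup_of_le hr le_rfl))
    refine le_trans ?_ (mul_le_mul_right h1 _)
    rw [volume_cube, ENNReal.mul_rpow_of_nonneg _ _ (by positivity : (0 : ℝ) ≤ 1 / p),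
      ← mul_assoc, ← mul_assoc]
    refine le_mul_of_one_le_left zero_le ?_
    have hrn : ENNReal.ofReal r ^ n ≠ 0 := by simp [hr]
    have hrn' : ENNReal.ofReal r ^ n ≠ ∞ := by simp
    calc (1 : ℝ≥0∞) = ENNReal.ofReal (1 / c * (c * r ^ ((n : ℝ) / p))) *
          ((ENNReal.ofReal r ^ n)⁻¹) ^ (1 / p) := by
          rw [← mul_assoc, one_div_mul_cancel hc.ne', one_mul, ofReal_rpow_div hr,
            ← ENNReal.mul_rpow_of_nonneg _ _ (by positivity), ENNReal.mul_inv_cancel hrn hrn',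
            ENNReal.one_rpow]
      _ ≤ _ := by
          rw [← ENNReal.ofReal_mul (by positivity)]
          gcongr
          exact h r hr
  have hU : (⋃ k : ℕ, cube n 0 ((k : ℝ) + 1)) = univ := by
    refine eq_univ_of_forall fun y => ?_
    obtain ⟨k, hk⟩ := exists_nat_ge (2 * ‖y‖)
    refine mem_iUnion.2 ⟨k, fun i => ?_⟩
    have := PiLp.norm_apply_le y i
    simp only [Real.norm_eq_abs] at this
    simp only [PiLp.zero_apply, sub_zero]
    linarith
  have hmono : Monotone fun k : ℕ => cube n 0 ((k : ℝ) + 1) := fun k l hkl y hy i => by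
    have : (k : ℝ) ≤ l := by exact_mod_cast hkl
    exact (hy i).trans (by linarith)
  have hsup := setLIntegral_iUnion_of_directed (μ := volume)
    (fun y => ENNReal.ofReal (‖f y‖ ^ p)) hmono.directed_le
  rw [hU, Measure.restrict_univ] at hsup
  rw [hsup, one_div, ENNReal.rpow_inv_le_iff hp]
  refine iSup_le fun k => ?_
  rw [← ENNReal.rpow_inv_le_iff hp, ← one_div]
  exact key _ (by positivity)

lemma morreyNorm_le_one {n : ℕ} {p : ℝ} (hp : 0 < p) {φ : ℝ → ℝ} (hφ : GClass n p φ)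
    (hφ1 : φ 1 = 1) {f : En n → ℝ} {δ : ℝ} {B : ℝ≥0∞}
    (hB : ENNReal.ofReal (φ δ) * B ^ (1 / p) ≤ 1)
    (hfB : ∀ y, ENNReal.ofReal (‖f y‖ ^ p) ≤ B)
    (hf : ∫⁻ y, ENNReal.ofReal (‖f y‖ ^ p) ≤ 1)
    (hfr : ∀ x r, δ ≤ r → r < 1 →
      ∫⁻ y in cube n x r, ENNReal.ofReal (‖f y‖ ^ p) ≤ ENNReal.ofReal r ^ n) :
    morreyNorm n p φ f ≤ 1 := by
  refine iSup_le fun x => iSup_le fun r => iSup_le fun hr => ?_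
  have hrn : ENNReal.ofReal r ^ n ≠ 0 := by simp [hr]
  have hrn' : ENNReal.ofReal r ^ n ≠ ∞ := by simp
  have key : ∀ D : ℝ≥0∞,
      ∫⁻ y in cube n x r, ENNReal.ofReal (‖f y‖ ^ p) ≤ ENNReal.ofReal r ^ n * D →
      ENNReal.ofReal (φ r) * D ^ (1 / p) ≤ 1 →
      ENNReal.ofReal (φ r) * ((volume (cube n x r))⁻¹ *
        ∫⁻ y in cube n x r, ENNReal.ofReal (‖f y‖ ^ p)) ^ (1 / p) ≤ 1 := by
    intro D h1 h2
    refine le_trans (mul_le_mul_right (ENNReal.rpow_le_rpow ?_ (by positivity)) _) h2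
    rw [volume_cube]
    refine (mul_le_mul_right h1 _).trans ?_
    rw [← mul_assoc, ENNReal.inv_mul_cancel hrn hrn', one_mul]
  rcases le_or_gt 1 r with h1 | h1
  · refine key (ENNReal.ofReal r ^ n)⁻¹ ?_ ?_
    · rw [ENNReal.mul_inv_cancel hrn hrn']
      exact (setLIntegral_le_lintegral _ _).trans hf
    · have h2 := (hφ.2 1 r one_pos h1).2
      rw [hφ1, one_mul, div_one] at h2
      refine (mul_le_mul_left (ENNReal.ofReal_le_ofReal h2) _).trans ?_
      rw [ofReal_rpow_div hr, ← ENNReal.mul_rpow_of_nonneg _ _ (by positivity),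
        ENNReal.mul_inv_cancel hrn hrn', ENNReal.one_rpow]
  rcases le_or_gt δ r with h2 | h2
  · refine key 1 (by simpa using hfr x r h2 h1) ?_
    have h3 := (hφ.2 r 1 hr h1.le).1
    rw [hφ1] at h3
    simpa using h3
  · refine key B ?_ ((mul_le_mul_left (ENNReal.ofReal_le_ofReal (hφ.2 r δ hr h2.le).1) _).trans hB)
    calc _ ≤ ∫⁻ y in cube n x r, B := lintegral_mono fun y => hfB y
      _ = _ := by rw [setLIntegral_const, volume_cube, mul_comm]

lemma exists_rearr_ge_of_large {n : ℕ} (hn : 0 < n) {p : ℝ} (hp : 0 < p) {φ : ℝ → ℝ}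
    (hφ : GClass n p φ) (hφ1 : φ 1 = 1) {t : ℝ} (ht : 1 / 2 ≤ t) :
    ∃ f : En n → ℝ, Measurable f ∧ morreyNorm n p φ f ≤ 1 ∧
      ENNReal.ofReal ((2 * t) ^ (-(1 / p))) ≤ rearr n f t := by
  have ht0 : 0 < 2 * t := by linarith
  set R : ℝ := (2 * t) ^ (1 / (n : ℝ)) with hR
  have hR0 : 0 < R := by positivity
  have hvol : volume (cube n 0 R) = ENNReal.ofReal (2 * t) := by
    rw [volume_cube, ← ENNReal.ofReal_pow hR0.le, hR, ← Real.rpow_natCast, ← Real.rpow_mul ht0.le,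
      one_div_mul_cancel (by positivity), Real.rpow_one]
  have hmeas : MeasurableSet (cube n 0 R) := by
    rw [cube_eq_box]; exact measurableSet_box fun i => measurableSet_Icc
  set κ : ℝ := (2 * t) ^ (-(1 / p)) with hκ
  have hκ0 : 0 < κ := by positivity
  have hκp : κ ^ p = (2 * t)⁻¹ := by
    rw [hκ, ← Real.rpow_mul ht0.le, neg_mul, one_div_mul_cancel hp.ne', Real.rpow_neg_one]
  have hF : ∀ y, ENNReal.ofReal (‖(cube n 0 R).indicator (fun _ => κ) y‖ ^ p) =
      (cube n 0 R).indicator (fun _ => ENNReal.ofReal (2 * t)⁻¹) y := fun y => by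
    by_cases hy : y ∈ cube n 0 R
    · simp only [indicator_of_mem hy, Real.norm_of_nonneg hκ0.le, hκp]
    · simp [indicator_of_notMem hy, Real.zero_rpow hp.ne']
  refine ⟨(cube n 0 R).indicator fun _ => κ, measurable_const.indicator hmeas,
    morreyNorm_le_one hp hφ hφ1 (δ := 1) (B := 1) (by simp [hφ1]) ?_ ?_
      (fun x r h1 h2 => absurd h1 (not_le.2 h2)), le_rearr ?_⟩
  · intro y
    rw [hF]
    refine (indicator_le_self _ _ y).trans ?_
    simpa using inv_le_one_of_one_le₀ (by linarith : 1 ≤ 2 * t)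
  · simp_rw [hF]
    rw [lintegral_indicator_const hmeas, hvol, ← ENNReal.ofReal_mul (by positivity),
      inv_mul_cancel₀ ht0.ne', ENNReal.ofReal_one]
  · refine lt_of_lt_of_le (b := volume (cube n 0 R)) ?_ (measure_mono fun y hy => ?_)
    · rw [hvol, ENNReal.ofReal_lt_ofReal_iff ht0]; linarith
    · simp only [mem_ofPred_eq, indicator_of_mem hy, Real.norm_of_nonneg hκ0.le, le_refl]

lemma lintegral_inv_Ioc {a b : ℝ} (ha : 0 < a) (hab : a ≤ b) :
    ∫⁻ s in Ioc a b, ENNReal.ofReal s⁻¹ = ENNReal.ofReal (Real.log (b / a)) := by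
  have hint : IntervalIntegrable (fun s : ℝ => s⁻¹) volume a b :=
    intervalIntegral.intervalIntegrable_inv
      (fun s hs => by rw [uIcc_of_le hab] at hs; linarith [hs.1]) continuousOn_id
  rw [← integral_inv_of_pos ha (ha.trans_le hab), intervalIntegral.integral_of_le hab,
    ofReal_integral_eq_lintegral_ofReal hint.1]
  filter_upwards [ae_restrict_mem measurableSet_Ioc] with s hs
  exact inv_nonneg.2 (ha.le.trans hs.1.le)

/-- The `p`-th power of the profile used for the extremal functions. -/
noncomputable def profile (a b s : ℝ) : ℝ :=
  if s < b then (3 * (1 + Real.log (b / a)) * max s a)⁻¹ else 0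

lemma measurable_profile (a b : ℝ) : Measurable (profile a b) :=
  Measurable.ite measurableSet_Iio (by fun_prop) measurable_const

lemma log_div_nonneg {a b : ℝ} (ha : 0 < a) (hab : a ≤ b) : 0 ≤ Real.log (b / a) :=
  Real.log_nonneg ((one_le_div ha).2 hab)

lemma profile_nonneg {a b : ℝ} (ha : 0 < a) (hab : a ≤ b) (s : ℝ) : 0 ≤ profile a b s := by
  have h := log_div_nonneg ha hab
  have h2 : 0 ≤ max s a := le_max_of_le_right ha.le
  unfold profile
  split_ifs <;> positivity

lemma profile_le {a b : ℝ} (ha : 0 < a) (hab : a ≤ b) {s u : ℝ} (hu : 0 < u) (h : u ≤ max s a) :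
    profile a b s ≤ (3 * (1 + Real.log (b / a)) * u)⁻¹ := by
  have hL := log_div_nonneg ha hab
  unfold profile
  split_ifs
  · gcongr
  · positivity

lemma lintegral_profile_le {a b : ℝ} (ha : 0 < a) (hab : a ≤ b) :
    ∫⁻ s in Ico (0 : ℝ) 1, ENNReal.ofReal (profile a b s) ≤ ENNReal.ofReal (1 / 3) := by
  have hL := log_div_nonneg ha hab
  set L := Real.log (b / a) with hLdef
  have hsub : Ico (0 : ℝ) 1 ⊆ (Ico 0 a ∪ Icc a b) ∪ Ioi b := fun s hs => by
    rcases lt_or_ge s a with h | h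
    · exact Or.inl (Or.inl ⟨hs.1, h⟩)
    rcases le_or_gt s b with h' | h'
    · exact Or.inl (Or.inr ⟨h, h'⟩)
    · exact Or.inr h'
  have h1 : ∫⁻ s in Ico 0 a, ENNReal.ofReal (profile a b s) ≤
      ENNReal.ofReal (3 * (1 + L))⁻¹ := by
    calc _ ≤ ∫⁻ s in Ico 0 a, ENNReal.ofReal (3 * (1 + L) * a)⁻¹ :=
          lintegral_mono fun s =>
            ENNReal.ofReal_le_ofReal (profile_le ha hab ha (le_max_right _ _))
      _ = _ := by
          rw [setLIntegral_const, Real.volume_Ico, sub_zero,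
            ← ENNReal.ofReal_mul (by positivity)]
          congr 1
          field_simp
  have h2 : ∫⁻ s in Icc a b, ENNReal.ofReal (profile a b s) ≤
      ENNReal.ofReal ((3 * (1 + L))⁻¹ * L) := by
    calc _ = ∫⁻ s in Ioc a b, ENNReal.ofReal (profile a b s) :=
          setLIntegral_congr Ioc_ae_eq_Icc.symm
      _ ≤ ∫⁻ s in Ioc a b, ENNReal.ofReal (3 * (1 + L))⁻¹ * ENNReal.ofReal s⁻¹ := by
          refine setLIntegral_mono' measurableSet_Ioc fun s hs => ?_
          rw [← ENNReal.ofReal_mul (by positivity), ← mul_inv]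
          exact ENNReal.ofReal_le_ofReal
            (profile_le ha hab (ha.trans hs.1) (le_max_left _ _))
      _ = _ := by
          rw [lintegral_const_mul _ (by fun_prop), lintegral_inv_Ioc ha hab,
            ← ENNReal.ofReal_mul (by positivity)]
  have h3 : ∫⁻ s in Ioi b, ENNReal.ofReal (profile a b s) = 0 := by
    rw [setLIntegral_congr_fun (g := fun _ => 0) measurableSet_Ioi, lintegral_zero]
    intro s hs
    simp [profile, not_lt.2 (le_of_lt (mem_Ioi.1 hs))]
  calc _ ≤ ∫⁻ s in (Ico 0 a ∪ Icc a b) ∪ Ioi b, ENNReal.ofReal (profile a b s) :=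
        lintegral_mono_set hsub
    _ ≤ (ENNReal.ofReal (3 * (1 + L))⁻¹ + ENNReal.ofReal ((3 * (1 + L))⁻¹ * L)) + 0 :=
        (lintegral_union_le _ _ _).trans (add_le_add
          ((lintegral_union_le _ _ _).trans (add_le_add h1 h2)) h3.le)
    _ = ENNReal.ofReal (1 / 3) := by
        rw [add_zero, ← ENNReal.ofReal_add (by positivity) (by positivity)]
        congr 1
        field_simp

lemma exists_rearr_ge_of_small {n : ℕ} (hn : 0 < n) {p : ℝ} (hp : 0 < p) {φ : ℝ → ℝ}
    (hφ : GClass n p φ) (hφ1 : φ 1 = 1) (hφ0 : Tendsto φ (nhdsWithin 0 (Ioi 0)) (nhds 0))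
    {a b : ℝ} (ha : 0 < a) (hab : a ≤ b) (hb : b ≤ 1) :
    ∃ f : En n → ℝ, Measurable f ∧ morreyNorm n p φ f ≤ 1 ∧
      ∀ t : ℝ, 0 < t → a ≤ 2 * t → 2 * t ≤ b →
        ENNReal.ofReal ((6 * (1 + Real.log (b / a)) * t) ^ (-(1 / p))) ≤ rearr n f t := by
  have hL := log_div_nonneg ha hab
  set B : ℝ := (3 * (1 + Real.log (b / a)) * a)⁻¹ with hBdef
  have hB0 : 0 < B := by positivity
  obtain ⟨N, hN0, hN⟩ : ∃ N : ℕ, 0 < N ∧ φ (1 / N) * B ^ (1 / p) ≤ 1 := by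
    have h1 : Tendsto (fun k : ℕ => 1 / ((k : ℝ) + 1)) atTop (nhdsWithin 0 (Ioi 0)) :=
      tendsto_nhdsWithin_iff.2 ⟨tendsto_one_div_add_atTop_nhds_zero_nat,
        Eventually.of_forall fun k => by simp only [mem_Ioi]; positivity⟩
    have h2 := ((hφ0.comp h1).mul_const (B ^ (1 / p))).eventually_le_const
      (show 0 * B ^ (1 / p) < 1 by simp)
    obtain ⟨k, hk⟩ := h2.exists
    exact ⟨k + 1, k.succ_pos, by push_cast; exact hk⟩
  have hN' : (0 : ℝ) < N := by exact_mod_cast hN0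
  set i₀ : Fin n := ⟨0, hn⟩
  set C : Set (En n) := {y | ∀ i, y i ∈ Ico (0 : ℝ) 1} with hC
  have hCm : MeasurableSet C := measurableSet_box fun i => measurableSet_Ico
  set W : ℝ → ℝ≥0∞ := fun s => ENNReal.ofReal (profile a b s) with hW
  have hWm : Measurable W := (measurable_profile a b).ennreal_ofReal
  have hCint : ∀ G : ℝ → ℝ≥0∞, Measurable G →
      ∫⁻ y in C, G (Int.fract (N * y i₀)) = ∫⁻ s in Ico (0 : ℝ) 1, G s := by
    intro G hG
    rw [hC, lintegral_box i₀ (fun i => measurableSet_Ico)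
      (H := fun s => G (Int.fract (N * s))) (hG.comp (by fun_prop))]
    have := lintegral_fract_Ico_nat G hG hN0 0 N
    simp only [Int.cast_zero, zero_div, zero_add, div_self hN'.ne', ENNReal.ofReal_one,
      one_mul] at this
    rw [this]
    simp
  set f : En n → ℝ := C.indicator fun y => profile a b (Int.fract (N * y i₀)) ^ (1 / p) with hf
  have hfm : Measurable f := by
    refine Measurable.indicator ?_ hCm
    have : Measurable fun y : En n => profile a b (Int.fract (N * y i₀)) :=
      (measurable_profile a b).comp (by fun_prop)
    fun_prop
  have hF : ∀ y, ENNReal.ofReal (‖f y‖ ^ p) =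
      C.indicator (fun y => W (Int.fract (N * y i₀))) y := fun y => by
    by_cases hy : y ∈ C
    · have h0 := profile_nonneg ha hab (Int.fract (N * y i₀))
      simp only [hf, hW, indicator_of_mem hy]
      rw [Real.norm_of_nonneg (by positivity), ← Real.rpow_mul h0, one_div_mul_cancel hp.ne',
        Real.rpow_one]
    · simp [hf, indicator_of_notMem hy, Real.zero_rpow hp.ne']
  refine ⟨f, hfm, morreyNorm_le_one hp hφ hφ1 (δ := 1 / N) (B := ENNReal.ofReal B)
    ?_ ?_ ?_ ?_, ?_⟩
  · rw [ENNReal.ofReal_rpow_of_pos hB0, ← ENNReal.ofReal_mul (hφ.1 _ (by positivity)).le]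
    simpa using hN
  · intro y
    rw [hF]
    exact (indicator_le_self _ _ y).trans
      (ENNReal.ofReal_le_ofReal (profile_le ha hab ha (le_max_right _ _)))
  · simp_rw [hF]
    rw [lintegral_indicator hCm, hCint W hWm]
    refine (lintegral_profile_le ha hab).trans ?_
    simp only [ENNReal.ofReal_le_one]
    norm_num
  · intro x r hr _
    have hr0 : 0 < r := lt_of_lt_of_le (by positivity) hr
    calc ∫⁻ y in cube n x r, ENNReal.ofReal (‖f y‖ ^ p)
        ≤ ∫⁻ y in cube n x r, W (Int.fract (N * y i₀)) := lintegral_mono fun y => by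
          rw [hF]; exact indicator_le_self _ _ y
      _ = (∏ j ∈ Finset.univ.erase i₀, volume (Icc (x j - r / 2) (x j + r / 2))) *
          ∫⁻ s in Icc (x i₀ - r / 2) (x i₀ + r / 2), W (Int.fract (N * s)) := by
          rw [cube_eq_box, lintegral_box i₀ (fun i => measurableSet_Icc)
            (H := fun s => W (Int.fract (N * s))) (hWm.comp (by fun_prop))]
      _ ≤ ENNReal.ofReal r ^ (n - 1) * (ENNReal.ofReal (3 * r) * ENNReal.ofReal (1 / 3)) := by
          refine mul_le_mul' (le_of_eq ?_) ((lintegral_fract_Icc_le W hWm hN0 _ _ ?_).trans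
            (mul_le_mul_right (lintegral_profile_le ha hab) _))
          · rw [Finset.prod_congr rfl (g := fun _ => ENNReal.ofReal r) (fun j _ => by
              rw [Real.volume_Icc]; congr 1; ring)]
            simp
          · rwa [div_le_iff₀' hN'] at hr
      _ = ENNReal.ofReal r ^ n := by
          rw [← ENNReal.ofReal_mul (by positivity), show 3 * r * (1 / 3) = r by ring,
            ← pow_succ, Nat.sub_add_cancel hn]
  · intro t ht hat htb
    refine le_rearr ?_
    have hS : MeasurableSet {y : En n | Int.fract (N * y i₀) < 2 * t} :=
      measurableSet_lt (by fun_prop) measurable_const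
    have hvol : volume ({y : En n | Int.fract (N * y i₀) < 2 * t} ∩ C) =
        ENNReal.ofReal (2 * t) := by
      rw [← Measure.restrict_apply hS, ← lintegral_indicator_one hS]
      have := hCint ((Iio (2 * t)).indicator 1) (measurable_one.indicator measurableSet_Iio)
      rw [lintegral_indicator_one measurableSet_Iio, Measure.restrict_apply measurableSet_Iio,
        inter_comm, Ico_inter_Iio, min_eq_right (htb.trans hb), Real.volume_Ico, sub_zero] at this
      rw [← this]
      rfl
    refine lt_of_lt_of_le (b := ENNReal.ofReal (2 * t)) ?_ ?_
    · rw [ENNReal.ofReal_lt_ofReal_iff (by positivity)]; linarith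
    · rw [← hvol]
      refine measure_mono fun y hy => ?_
      have h0 := profile_nonneg ha hab (Int.fract (N * y i₀))
      simp only [mem_ofPred_eq, hf, indicator_of_mem hy.2]
      rw [Real.norm_of_nonneg (by positivity)]
      refine ENNReal.ofReal_le_ofReal ?_
      rw [Real.rpow_neg (by positivity), ← Real.inv_rpow (by positivity)]
      refine Real.rpow_le_rpow (by positivity) ?_ (by positivity)
      rw [profile, if_pos (lt_of_lt_of_le hy.1 htb),
        show 6 * (1 + Real.log (b / a)) * t = 3 * (1 + Real.log (b / a)) * (2 * t) by ring]
      have : 0 < max (Int.fract (N * y i₀)) a := lt_max_of_lt_right ha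
      gcongr
      exact max_le (le_of_lt hy.1) hat

lemma GClass.const_mul_rpow_le {n : ℕ} {p : ℝ} {φ : ℝ → ℝ} (hφ : GClass n p φ) {c : ℝ}
    (hc : Tendsto (fun t : ℝ => φ t / t ^ ((n : ℝ) / p)) atTop (nhds c)) {r : ℝ} (hr : 0 < r) :
    c * r ^ ((n : ℝ) / p) ≤ φ r := by
  rw [← le_div_iff₀ (by positivity)]
  refine le_of_tendsto hc ?_
  filter_upwards [eventually_ge_atTop r] with R hR
  have hR0 : 0 < R := hr.trans_le hR
  have h := (hφ.2 r R hr hR).2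
  rw [Real.div_rpow hR0.le hr.le] at h
  rw [div_le_iff₀ (by positivity)]
  exact h.trans (le_of_eq (by ring))

lemma ofReal_rpow_mul_rpow_div {p t : ℝ} (hp : 0 < p) (ht : 0 < t) (A : ℝ≥0∞) :
    (ENNReal.ofReal (t ^ (1 / p)) * A) ^ p / ENNReal.ofReal t = A ^ p := by
  rw [ENNReal.mul_rpow_of_nonneg _ _ hp.le, ENNReal.ofReal_rpow_of_pos (by positivity),
    ← Real.rpow_mul ht.le, one_div_mul_cancel hp.ne', Real.rpow_one, mul_comm,
    ENNReal.mul_div_cancel_right (by simp [ht]) (by simp)]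

lemma one_le_of_forall_le_mul_rpow {K q : ℝ}
    (h : ∀ L : ℝ, 1 ≤ L → L ≤ K * (1 + L) ^ q) : 1 ≤ q := by
  by_contra! hq
  have h1 := (tendsto_rpow_atTop (sub_pos.2 hq)).eventually_gt_atTop (2 * K)
  obtain ⟨u, hu, hu2⟩ := (h1.and (eventually_ge_atTop 2)).exists
  have hu0 : 0 < u := by linarith
  have h2 := h (u - 1) (by linarith)
  rw [add_sub_cancel] at h2
  have h3 : 0 < u ^ q := by positivity
  have h4 : u ^ (1 - q) * u ^ q = u := by rw [← Real.rpow_add hu0]; simp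
  nlinarith

lemma exponent_le_of_envelope_inequality {n : ℕ} (hn : 0 < n) {p : ℝ} (hp : 0 < p) {φ : ℝ → ℝ}
    (hφ : GClass n p φ) (hφ1 : φ 1 = 1) (hφ0 : Tendsto φ (nhdsWithin 0 (Ioi 0)) (nhds 0))
    {v ε c : ℝ} (hv : 0 < v) (hε : 0 < ε) (hc : 0 < c)
    (h : ∀ f : En n → ℝ, Measurable f →
      (∫⁻ t in Ioo (0 : ℝ) ε,
        (ENNReal.ofReal (t ^ (1 / p)) * rearr n f t) ^ v / ENNReal.ofReal t) ^ (1 / v)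
          ≤ ENNReal.ofReal c * morreyNorm n p φ f) : p ≤ v := by
  rw [← one_le_div hp]
  refine one_le_of_forall_le_mul_rpow (K := c ^ v * 6 ^ (v / p)) fun L hL => ?_
  set b := min ε 1 with hbdef
  have hb : 0 < b := lt_min hε one_pos
  have hL0 : 0 < 1 + L := by linarith
  set a := b * Real.exp (-L) with hadef
  have ha : 0 < a := by positivity
  have hab : a ≤ b := mul_le_of_le_one_right hb.le (Real.exp_le_one_iff.2 (by linarith))
  have hlog : Real.log (b / a) = L := by
    rw [hadef, div_mul_cancel_left₀ hb.ne', ← Real.exp_neg, neg_neg, Real.log_exp]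
  obtain ⟨f, hfm, hf1, hf⟩ :=
    exists_rearr_ge_of_small hn hp hφ hφ1 hφ0 ha hab (min_le_right ε 1)
  rw [hlog] at hf
  have h1 : ∫⁻ t in Ioo (0 : ℝ) ε,
      (ENNReal.ofReal (t ^ (1 / p)) * rearr n f t) ^ v / ENNReal.ofReal t ≤
        ENNReal.ofReal (c ^ v) := by
    have := (h f hfm).trans ((mul_le_mul_right hf1 _).trans_eq (mul_one _))
    rwa [one_div v, ENNReal.rpow_inv_le_iff hv, ENNReal.ofReal_rpow_of_pos hc] at this
  have h2 : ENNReal.ofReal (((6 * (1 + L)) ^ (v / p))⁻¹ * L) ≤ ∫⁻ t in Ioo (0 : ℝ) ε,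
      (ENNReal.ofReal (t ^ (1 / p)) * rearr n f t) ^ v / ENNReal.ofReal t := by
    have hsub : Ioc (a / 2) (b / 2) ⊆ Ioo 0 ε := fun t ht =>
      ⟨lt_trans (by positivity) ht.1, by linarith [ht.2, min_le_left ε 1]⟩
    have hquot : b / 2 / (a / 2) = b / a := by field_simp
    calc _ = ∫⁻ t in Ioc (a / 2) (b / 2),
          ENNReal.ofReal ((6 * (1 + L)) ^ (v / p))⁻¹ * ENNReal.ofReal t⁻¹ := by
          rw [lintegral_const_mul _ (by fun_prop), lintegral_inv_Ioc (by positivity) (by linarith),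
            ← ENNReal.ofReal_mul (by positivity), hquot, hlog]
      _ ≤ ∫⁻ t in Ioc (a / 2) (b / 2),
          (ENNReal.ofReal (t ^ (1 / p)) * rearr n f t) ^ v / ENNReal.ofReal t := by
          refine setLIntegral_mono' measurableSet_Ioc fun t ht => ?_
          have ht0 : 0 < t := lt_trans (by positivity) ht.1
          rw [ENNReal.ofReal_inv_of_pos ht0, ← div_eq_mul_inv]
          refine ENNReal.div_le_div_right ?_ _
          calc _ = (ENNReal.ofReal (t ^ (1 / p)) *
                ENNReal.ofReal ((6 * (1 + L) * t) ^ (-(1 / p)))) ^ v := by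
                rw [← ENNReal.ofReal_mul (by positivity), ENNReal.ofReal_rpow_of_pos (by positivity),
                  Real.mul_rpow (by positivity) ht0.le, mul_left_comm, ← Real.rpow_add ht0,
                  add_neg_cancel, Real.rpow_zero, mul_one, ← Real.rpow_mul (by positivity),
                  ← Real.rpow_neg (by positivity)]
                congr 2
                ring
            _ ≤ _ := by
                gcongr
                exact hf t ht0 (by linarith [ht.1]) (by linarith [ht.2])
      _ ≤ _ := lintegral_mono_set hsub
  have h3 := (ENNReal.ofReal_le_ofReal_iff (by positivity)).1 (h2.trans h1)
  rw [inv_mul_le_iff₀ (by positivity), Real.mul_rpow (by norm_num) hL0.le] at h3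
  linarith

/-- Under `lim_{t→0⁺} φ(t)=0` and `lim_{t→∞} t^{-n/p} φ(t) > 0`, the growth
envelope of `ℳ_{φ,p}(ℝⁿ)` is `(t^{-1/p}, p)`, the growth envelope of `L_p(ℝⁿ)`:
(1) `𝔈_G ℳ_{φ,p}(t) ∼ t^{-1/p}`; (2) the envelope inequality holds with fine index `p`;
(3) any admissible fine index `v` satisfies `v ≥ p`. -/
theorem statement7 (n : ℕ) (hn : 0 < n) (p : ℝ) (hp : 0 < p) (φ : ℝ → ℝ)
    (hφ : GClass n p φ) (hφ1 : φ 1 = 1)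
    (hφ0 : Filter.Tendsto φ (nhdsWithin 0 (Set.Ioi 0)) (nhds 0))
    (hinf : ∃ c : ℝ, 0 < c ∧
      Filter.Tendsto (fun t : ℝ => φ t / t ^ ((n : ℝ) / p)) Filter.atTop (nhds c)) :
    (∃ c₁ c₂ : ℝ, 0 < c₁ ∧ c₁ ≤ c₂ ∧ ∀ t : ℝ, 0 < t →
        ENNReal.ofReal (c₁ * t ^ (-(1 / p))) ≤ morreyEnvelope n p φ t ∧
        morreyEnvelope n p φ t ≤ ENNReal.ofReal (c₂ * t ^ (-(1 / p)))) ∧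
    (∃ ε c : ℝ, 0 < ε ∧ 0 < c ∧ ∀ f : En n → ℝ, Measurable f →
        (∫⁻ t in Set.Ioo (0 : ℝ) ε,
            (ENNReal.ofReal (t ^ (1 / p)) * rearr n f t) ^ p / ENNReal.ofReal t) ^ (1 / p)
          ≤ ENNReal.ofReal c * morreyNorm n p φ f) ∧
    (∀ v : ℝ, 0 < v →
      (∃ ε c : ℝ, 0 < ε ∧ 0 < c ∧ ∀ f : En n → ℝ, Measurable f →
        (∫⁻ t in Set.Ioo (0 : ℝ) ε,
            (ENNReal.ofReal (t ^ (1 / p)) * rearr n f t) ^ v / ENNReal.ofReal t) ^ (1 / v)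
          ≤ ENNReal.ofReal c * morreyNorm n p φ f) → p ≤ v) := by
  obtain ⟨c, hc, hlim⟩ := hinf
  have hnorm := lintegral_le_morreyNorm hp hc (fun r hr => hφ.const_mul_rpow_le hlim hr)
  refine ⟨⟨6 ^ (-(1 / p)), max (6 ^ (-(1 / p))) (1 / c), by positivity, le_max_left _ _,
    fun t ht => ⟨?_, ?_⟩⟩, ⟨1, 1 / c, one_pos, by positivity, fun f hf => ?_⟩, ?_⟩
  · rw [← Real.mul_rpow (by norm_num) ht.le]
    rcases le_or_gt (1 / 2) t with h | h
    · obtain ⟨f, hfm, hf1, hf⟩ := exists_rearr_ge_of_large hn hp hφ hφ1 h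
      refine le_trans (ENNReal.ofReal_le_ofReal ?_)
        (hf.trans (le_iSup_of_le f (le_iSup_of_le hfm (le_iSup_of_le hf1 le_rfl))))
      exact Real.rpow_le_rpow_of_nonpos (by positivity) (by linarith)
        (neg_nonpos.2 (by positivity))
    · obtain ⟨f, hfm, hf1, hf⟩ := exists_rearr_ge_of_small hn hp hφ hφ1 hφ0
        (a := 2 * t) (b := 2 * t) (by positivity) le_rfl (by linarith)
      have := hf t ht le_rfl le_rfl
      rw [div_self (by positivity), Real.log_one, add_zero, mul_one] at this
      exact this.trans (le_iSup_of_le f (le_iSup_of_le hfm (le_iSup_of_le hf1 le_rfl)))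
  · refine iSup_le fun f => iSup_le fun hf => iSup_le fun hf1 => ?_
    have hI := (hnorm f).trans ((mul_le_mul_right hf1 _).trans_eq (mul_one _))
    refine (rearr_le_of_lintegral hp hf ht).trans ?_
    rw [ENNReal.div_rpow_of_nonneg _ _ (by positivity), ENNReal.ofReal_mul (by positivity),
      Real.rpow_neg ht.le, ENNReal.ofReal_inv_of_pos (by positivity), div_eq_mul_inv,
      ENNReal.ofReal_rpow_of_pos ht]
    gcongr
    exact hI.trans (ENNReal.ofReal_le_ofReal (le_max_right _ _))
  · refine le_trans (ENNReal.rpow_le_rpow ?_ (by positivity)) (hnorm f)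
    calc _ = ∫⁻ t in Ioo (0 : ℝ) 1, rearr n f t ^ p :=
          setLIntegral_congr_fun measurableSet_Ioo fun t ht =>
            ofReal_rpow_mul_rpow_div hp ht.1 _
      _ ≤ ∫⁻ t in Ioi (0 : ℝ), rearr n f t ^ p := lintegral_mono_set Ioo_subset_Ioi_self
      _ ≤ _ := lintegral_rearr_rpow_le hp hf
  · rintro v hv ⟨ε, d, hε, hd, h⟩
    exact exponent_le_of_envelope_inequality hn hp hφ hφ1 hφ0 hv hε hd h
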